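/- There is no real polynomial P of degree 8 that defines the sign pattern (+,+,+,−,−,−,−,+,+), has no positive real roots, and has exactly six negative real roots, each simple (equivalently, six distinct simple negative roots and one pair of non-real complex conjugate roots). In other words, the sign pattern (+,+,+,−,−,−,−,+,+) is not realizable with the admissible pair (0,6). -/

import Mathlib

open Polynomial

/-- A degree-8 real polynomial `P` defines the sign pattern `σ = (σ_0, …, σ_8)`
(with entries `1` for `+`, `-1` for `−`) if for each `j` the coefficient of
`x^(8-j)` is nonzero and has sign `σ_j`. -/
def definesSignPattern (P : Polynomial ℝ) (σ : Fin 9 → ℝ) : Prop :=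
  ∀ j : Fin 9, Real.sign (P.coeff (8 - (j : ℕ))) = σ j

/-- The elementary symmetric polynomial of degree 1 in six real numbers. -/
def esymmSix1 (a b c d e f : ℝ) : ℝ :=
  a + b + c + d + e + f

/-- The elementary symmetric polynomial of degree 2 in six real numbers. -/
def esymmSix2 (a b c d e f : ℝ) : ℝ :=
  a * b + a * c + a * d + a * e + a * f + b * c + b * d + b * e + b * f + c * d + c * e +
    c * f + d * e + d * f + e * f

/-- The elementary symmetric polynomial of degree 3 in six real numbers. -/
def esymmSix3 (a b c d e f : ℝ) : ℝ :=
  a * b * c + a * b * d + a * b * e + a * b * f + a * c * d + a * c * e + a * c * f +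
    a * d * e + a * d * f + a * e * f + b * c * d + b * c * e + b * c * f + b * d * e +
    b * d * f + b * e * f + c * d * e + c * d * f + c * e * f + d * e * f

/-- The elementary symmetric polynomial of degree 4 in six real numbers. -/
def esymmSix4 (a b c d e f : ℝ) : ℝ :=
  a * b * c * d + a * b * c * e + a * b * c * f + a * b * d * e + a * b * d * f +
    a * b * e * f + a * c * d * e + a * c * d * f + a * c * e * f + a * d * e * f +
    b * c * d * e + b * c * d * f + b * c * e * f + b * d * e * f + c * d * e * f

/-- The elementary symmetric polynomial of degree 5 in six real numbers. -/
def esymmSix5 (a b c d e f : ℝ) : ℝ :=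
  a * b * c * d * e + a * b * c * d * f + a * b * c * e * f + a * b * d * e * f +
    a * c * d * e * f + b * c * d * e * f

/-- The elementary symmetric polynomial of degree 6 in six real numbers. -/
def esymmSix6 (a b c d e f : ℝ) : ℝ :=
  a * b * c * d * e * f

/-- The monomial symmetric polynomial of type `(2, 2, 1, 0)` in four real numbers. -/
def pairSqSum (p q r s : ℝ) : ℝ :=
  p ^ 2 * q ^ 2 * (r + s) + p ^ 2 * r ^ 2 * (q + s) + p ^ 2 * s ^ 2 * (q + r) +
    q ^ 2 * r ^ 2 * (p + s) + q ^ 2 * s ^ 2 * (p + r) + r ^ 2 * s ^ 2 * (p + q)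

lemma pairSqSum_nonneg {p q r s : ℝ} (hp : 0 < p) (hq : 0 < q) (hr : 0 < r) (hs : 0 < s) :
    0 ≤ pairSqSum p q r s := by
  unfold pairSqSum
  positivity

section SixPositive

variable {a b c d e f : ℝ}

lemma four_mul_esymmSix2_mul_esymmSix5_le (ha : 0 < a) (hb : 0 < b) (hc : 0 < c) (hd : 0 < d)
    (he : 0 < e) (hf : 0 < f) :
    4 * (esymmSix2 a b c d e f * esymmSix5 a b c d e f) ≤
      esymmSix3 a b c d e f * esymmSix4 a b c d e f +
        10 * (esymmSix1 a b c d e f * esymmSix6 a b c d e f) := by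
  have key : esymmSix3 a b c d e f * esymmSix4 a b c d e f +
      10 * (esymmSix1 a b c d e f * esymmSix6 a b c d e f) -
      4 * (esymmSix2 a b c d e f * esymmSix5 a b c d e f) = 1 / 6 * (
      (a - b) ^ 2 * pairSqSum c d e f +
      (a - c) ^ 2 * pairSqSum b d e f +
      (a - d) ^ 2 * pairSqSum b c e f +
      (a - e) ^ 2 * pairSqSum b c d f +
      (a - f) ^ 2 * pairSqSum b c d e +
      (b - c) ^ 2 * pairSqSum a d e f +
      (b - d) ^ 2 * pairSqSum a c e f +
      (b - e) ^ 2 * pairSqSum a c d f +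
      (b - f) ^ 2 * pairSqSum a c d e +
      (c - d) ^ 2 * pairSqSum a b e f +
      (c - e) ^ 2 * pairSqSum a b d f +
      (c - f) ^ 2 * pairSqSum a b d e +
      (d - e) ^ 2 * pairSqSum a b c f +
      (d - f) ^ 2 * pairSqSum a b c e +
      (e - f) ^ 2 * pairSqSum a b c d) := by
    unfold esymmSix1 esymmSix2 esymmSix3 esymmSix4 esymmSix5 esymmSix6 pairSqSum
    ring
  have h {u v p q r s : ℝ} (hp : 0 < p) (hq : 0 < q) (hr : 0 < r) (hs : 0 < s) :
      0 ≤ (u - v) ^ 2 * pairSqSum p q r s :=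
    mul_nonneg (sq_nonneg _) (pairSqSum_nonneg hp hq hr hs)
  rw [← sub_nonneg, key]
  refine mul_nonneg (by norm_num) ?_
  repeat' first | exact h ‹_› ‹_› ‹_› ‹_› | apply add_nonneg

lemma fifteen_mul_esymmSix1_mul_esymmSix6_le (ha : 0 < a) (hb : 0 < b) (hc : 0 < c)
    (hd : 0 < d) (he : 0 < e) (hf : 0 < f) :
    15 * (esymmSix1 a b c d e f * esymmSix6 a b c d e f) ≤
      esymmSix2 a b c d e f * esymmSix5 a b c d e f := by
  have key : esymmSix2 a b c d e f * esymmSix5 a b c d e f -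
      15 * (esymmSix1 a b c d e f * esymmSix6 a b c d e f) = 1 / 2 * (
      (a - b) ^ 2 * (c * d * e * f * (c + d + e + f)) +
      (a - c) ^ 2 * (b * d * e * f * (b + d + e + f)) +
      (a - d) ^ 2 * (b * c * e * f * (b + c + e + f)) +
      (a - e) ^ 2 * (b * c * d * f * (b + c + d + f)) +
      (a - f) ^ 2 * (b * c * d * e * (b + c + d + e)) +
      (b - c) ^ 2 * (a * d * e * f * (a + d + e + f)) +
      (b - d) ^ 2 * (a * c * e * f * (a + c + e + f)) +
      (b - e) ^ 2 * (a * c * d * f * (a + c + d + f)) +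
      (b - f) ^ 2 * (a * c * d * e * (a + c + d + e)) +
      (c - d) ^ 2 * (a * b * e * f * (a + b + e + f)) +
      (c - e) ^ 2 * (a * b * d * f * (a + b + d + f)) +
      (c - f) ^ 2 * (a * b * d * e * (a + b + d + e)) +
      (d - e) ^ 2 * (a * b * c * f * (a + b + c + f)) +
      (d - f) ^ 2 * (a * b * c * e * (a + b + c + e)) +
      (e - f) ^ 2 * (a * b * c * d * (a + b + c + d))) := by
    unfold esymmSix1 esymmSix2 esymmSix5 esymmSix6
    ring
  rw [← sub_nonneg, key]
  positivity

lemma five_mul_esymmSix1_mul_esymmSix5_le (ha : 0 < a) (hb : 0 < b) (hc : 0 < c)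
    (hd : 0 < d) (he : 0 < e) (hf : 0 < f) :
    5 * (esymmSix1 a b c d e f * esymmSix5 a b c d e f) ≤
      2 * (esymmSix2 a b c d e f * esymmSix4 a b c d e f) := by
  unfold esymmSix1 esymmSix2 esymmSix4 esymmSix5
  rw [← sub_nonneg]
  ring_nf
  positivity

/-- For positive numbers, the two displayed inequalities between consecutive elementary symmetric
polynomials are incompatible. -/
lemma esymmSix_incompatible (ha : 0 < a) (hb : 0 < b) (hc : 0 < c) (hd : 0 < d) (he : 0 < e)
    (hf : 0 < f) {t : ℝ} (ht : 0 < t)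
    (h₁ : esymmSix3 a b c d e f + t ^ 2 * esymmSix1 a b c d e f < 2 * t * esymmSix2 a b c d e f)
    (h₂ : esymmSix6 a b c d e f +
      t ^ 2 * esymmSix4 a b c d e f < 2 * t * esymmSix5 a b c d e f) : False := by
  have k₁ := four_mul_esymmSix2_mul_esymmSix5_le ha hb hc hd he hf
  have k₂ := fifteen_mul_esymmSix1_mul_esymmSix6_le ha hb hc hd he hf
  have k₃ := five_mul_esymmSix1_mul_esymmSix5_le ha hb hc hd he hf
  have p₁ : 0 < esymmSix1 a b c d e f := by unfold esymmSix1; positivity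
  have p₂ : 0 < esymmSix2 a b c d e f := by unfold esymmSix2; positivity
  have p₄ : 0 < esymmSix4 a b c d e f := by unfold esymmSix4; positivity
  have p₆ : 0 < esymmSix6 a b c d e f := by unfold esymmSix6; positivity
  generalize esymmSix1 a b c d e f = e₁ at *
  generalize esymmSix2 a b c d e f = e₂ at *
  generalize esymmSix3 a b c d e f = e₃ at *
  generalize esymmSix4 a b c d e f = e₄ at *
  generalize esymmSix5 a b c d e f = e₅ at *
  generalize esymmSix6 a b c d e f = e₆ at *
  have q₁ : t ^ 3 * (e₁ * e₄) + 2 * (e₂ * e₆) - 10 * t * (e₁ * e₆) < 0 := by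
    have m₁ := mul_lt_mul_of_pos_left h₁ (mul_pos ht p₄)
    have m₂ := mul_lt_mul_of_pos_left h₂ p₂
    have m₃ := mul_le_mul_of_nonneg_left k₁ ht.le
    linarith
  have q₂ : 75 * (e₁ ^ 2 * e₆) ≤ 2 * (e₂ ^ 2 * e₄) := by
    have m₁ := mul_le_mul_of_nonneg_left k₂ p₁.le
    have m₂ := mul_le_mul_of_nonneg_left k₃ p₂.le
    linarith
  have q₃ : e₆ * (75 / 2 * (t * e₁) ^ 3 + 2 * e₂ ^ 3 - 10 * (t * e₁) * e₂ ^ 2) < 0 := by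
    have m₁ := mul_neg_of_pos_of_neg (pow_pos p₂ 2) q₁
    have m₂ := mul_le_mul_of_nonneg_left q₂ (mul_pos (pow_pos ht 3) p₁).le
    linarith
  have q₄ : 75 / 2 * (t * e₁) ^ 3 + 2 * e₂ ^ 3 - 10 * (t * e₁) * e₂ ^ 2 =
      2 * ((e₂ - 10 / 3 * (t * e₁)) ^ 2 * (e₂ + 5 / 3 * (t * e₁))) +
        25 / 54 * (t * e₁) ^ 3 := by ring
  rw [q₄] at q₃
  exact absurd q₃ (not_lt.mpr (by positivity))

end SixPositive

/-- The coefficients of degrees `0`, `2`, `5` and `8` of the product of six linear factors and a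
quadratic polynomial. -/
lemma coeff_six_linear_mul_quadratic (a b c d e f k l m : ℝ) :
    let P := (X + C a) * (X + C b) * (X + C c) * (X + C d) * (X + C e) * (X + C f) *
      (C k * X ^ 2 + C l * X + C m)
    P.coeff 8 = k ∧
      P.coeff 5 = k * esymmSix3 a b c d e f + l * esymmSix2 a b c d e f +
        m * esymmSix1 a b c d e f ∧
      P.coeff 2 = k * esymmSix6 a b c d e f + l * esymmSix5 a b c d e f +
        m * esymmSix4 a b c d e f ∧
      P.coeff 0 = m * esymmSix6 a b c d e f := by
  intro P
  have hP : P = C k * X ^ 8 + C (k * esymmSix1 a b c d e f + l) * X ^ 7 +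
      C (k * esymmSix2 a b c d e f + l * esymmSix1 a b c d e f + m) * X ^ 6 +
      C (k * esymmSix3 a b c d e f + l * esymmSix2 a b c d e f +
        m * esymmSix1 a b c d e f) * X ^ 5 +
      C (k * esymmSix4 a b c d e f + l * esymmSix3 a b c d e f +
        m * esymmSix2 a b c d e f) * X ^ 4 +
      C (k * esymmSix5 a b c d e f + l * esymmSix4 a b c d e f +
        m * esymmSix3 a b c d e f) * X ^ 3 +
      C (k * esymmSix6 a b c d e f + l * esymmSix5 a b c d e f +
        m * esymmSix4 a b c d e f) * X ^ 2 +
      C (l * esymmSix6 a b c d e f + m * esymmSix5 a b c d e f) * X +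
        C (m * esymmSix6 a b c d e f) := by
    simp only [P, esymmSix1, esymmSix2, esymmSix3, esymmSix4, esymmSix5, esymmSix6, C_add, C_mul]
    ring
  rw [hP]
  refine ⟨?_, ?_, ?_, ?_⟩ <;> simp [coeff_X, coeff_C, coeff_X_pow, -map_add, -map_mul]

/-- A quadratic with positive leading and constant coefficients and no positive root has linear
coefficient greater than minus twice the geometric mean of the other two. -/
lemma neg_two_mul_lt_of_no_pos_root {α γ l : ℝ} (hα : 0 < α) (hγ : 0 < γ)
    (h : ∀ x : ℝ, 0 < x → α ^ 2 * x ^ 2 + l * x + γ ^ 2 ≠ 0) : -(2 * (α * γ)) < l := by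
  by_contra! hl
  have hαγ : 0 < α * γ := mul_pos hα hγ
  have hD : 0 ≤ l ^ 2 - 4 * (α * γ) ^ 2 := by nlinarith
  refine h ((-l + √(l ^ 2 - 4 * (α * γ) ^ 2)) / (2 * α ^ 2)) ?_ ?_
  · have := Real.sqrt_nonneg (l ^ 2 - 4 * (α * γ) ^ 2)
    exact div_pos (by linarith) (by positivity)
  · have hs := Real.sq_sqrt hD
    generalize √(l ^ 2 - 4 * (α * γ) ^ 2) = s at hs
    field_simp
    linear_combination hs

/-- A polynomial of degree 8 with six distinct roots is the product of the corresponding linear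
factors and a quadratic polynomial. -/
lemma exists_eq_prod_mul_quadratic {P : ℝ[X]} (hP : P.degree = 8) {z : Fin 6 → ℝ}
    (hz : Function.Injective z) (hr : ∀ i, P.eval (z i) = 0) :
    ∃ k l m : ℝ, P = (∏ i, (X - C (z i))) * (C k * X ^ 2 + C l * X + C m) := by
  obtain ⟨R, hR⟩ : (∏ i, (X - C (z i))) ∣ P :=
    Finset.prod_dvd_of_coprime
      (fun i _ j _ hij => pairwise_coprime_X_sub_C hz hij)
      (fun i _ => dvd_iff_isRoot.mpr (hr i))
  have hdeg : R.degree ≤ 2 := by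
    have h := congrArg degree hR
    rw [hP, degree_mul, degree_prod] at h
    simp only [degree_X_sub_C, Finset.sum_const, Finset.card_univ, Fintype.card_fin] at h
    have hR0 : R ≠ 0 := by
      rintro rfl
      simp at h
    rw [degree_eq_natDegree hR0] at h ⊢
    norm_cast at h ⊢
    simp at h
    norm_cast at h
    omega
  exact ⟨_, _, _, hR.trans (congrArg _ (eq_quadratic_of_degree_le_two hdeg))⟩

lemma pos_of_sign_eq_one {x : ℝ} (h : Real.sign x = 1) : 0 < x := by
  rcases lt_trichotomy x 0 with hx | rfl | hx
  · rw [Real.sign_of_neg hx] at h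
    norm_num at h
  · simp at h
  · exact hx

lemma neg_of_sign_eq_neg_one {x : ℝ} (h : Real.sign x = -1) : x < 0 :=
  neg_pos.mp (pos_of_sign_eq_one (by rw [Real.sign_neg, h, neg_neg]))

/-- The sign pattern (+,+,+,−,−,−,−,+,+) is not realizable with the
admissible pair (0,6): there is no degree 8 real polynomial defining this
pattern, with no positive real roots and exactly six negative real roots,
each simple. -/
theorem stmt0 :
    ¬ ∃ P : Polynomial ℝ, P.degree = 8 ∧
      definesSignPattern P ![1, 1, 1, -1, -1, -1, -1, 1, 1] ∧
      (∀ x : ℝ, 0 < x → P.eval x ≠ 0) ∧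
      ∃ z : Fin 6 → ℝ, StrictMono z ∧ (∀ i, z i < 0) ∧
        (∀ i, P.eval (z i) = 0) ∧ (∀ i, P.rootMultiplicity (z i) = 1) ∧
        (∀ x : ℝ, x < 0 → P.eval x = 0 → ∃ i, x = z i) := by
  rintro ⟨P, hdeg, hsign, hpos, z, hz, hneg, hroot, -, -⟩
  obtain ⟨k, l, m, hP⟩ := exists_eq_prod_mul_quadratic hdeg hz.injective hroot
  have s₈ : 0 < P.coeff 8 := pos_of_sign_eq_one (by simpa using hsign 0)
  have s₅ : P.coeff 5 < 0 := neg_of_sign_eq_neg_one (by simpa using hsign 3)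
  have s₂ : P.coeff 2 < 0 := neg_of_sign_eq_neg_one (by simpa using hsign 6)
  have s₀ : 0 < P.coeff 0 := pos_of_sign_eq_one (by simpa using hsign 8)
  obtain ⟨c₈, c₅, c₂, c₀⟩ :=
    coeff_six_linear_mul_quadratic (-z 0) (-z 1) (-z 2) (-z 3) (-z 4) (-z 5) k l m
  have hPz : P = (X + C (-z 0)) * (X + C (-z 1)) * (X + C (-z 2)) * (X + C (-z 3)) *
      (X + C (-z 4)) * (X + C (-z 5)) * (C k * X ^ 2 + C l * X + C m) := by
    rw [hP, Fin.prod_univ_six]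
    simp only [C_neg, sub_eq_add_neg]
  have n (i : Fin 6) : 0 < -z i := neg_pos.mpr (hneg i)
  rw [hPz, c₈] at s₈
  rw [hPz, c₅] at s₅
  rw [hPz, c₂] at s₂
  rw [hPz, c₀] at s₀
  have p₂ : 0 < esymmSix2 (-z 0) (-z 1) (-z 2) (-z 3) (-z 4) (-z 5) := by
    have := n 0; have := n 1; have := n 2; have := n 3; have := n 4; have := n 5
    unfold esymmSix2; positivity
  have p₅ : 0 < esymmSix5 (-z 0) (-z 1) (-z 2) (-z 3) (-z 4) (-z 5) := by
    have := n 0; have := n 1; have := n 2; have := n 3; have := n 4; have := n 5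
    unfold esymmSix5; positivity
  have p₆ : 0 < esymmSix6 (-z 0) (-z 1) (-z 2) (-z 3) (-z 4) (-z 5) := by
    have := n 0; have := n 1; have := n 2; have := n 3; have := n 4; have := n 5
    unfold esymmSix6; positivity
  have hm : 0 < m := pos_of_mul_pos_left s₀ p₆.le
  obtain ⟨α, hα, rfl⟩ : ∃ α : ℝ, 0 < α ∧ k = α ^ 2 :=
    ⟨√k, Real.sqrt_pos.mpr s₈, (Real.sq_sqrt s₈.le).symm⟩
  obtain ⟨γ, hγ, rfl⟩ : ∃ γ : ℝ, 0 < γ ∧ m = γ ^ 2 :=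
    ⟨√m, Real.sqrt_pos.mpr hm, (Real.sq_sqrt hm.le).symm⟩
  have hl : -(2 * (α * γ)) < l := by
    refine neg_two_mul_lt_of_no_pos_root hα hγ fun x hx h => hpos x hx ?_
    rw [hP, eval_mul]
    simp [h]
  have scale {u v w : ℝ} (hv : 0 < v) (h : α ^ 2 * u + l * v + γ ^ 2 * w < 0) :
      u + (γ / α) ^ 2 * w < 2 * (γ / α) * v := by
    have h' := mul_lt_mul_of_pos_right hl hv
    have e : u + (γ / α) ^ 2 * w - 2 * (γ / α) * v =
        (α ^ 2 * u - 2 * (α * γ) * v + γ ^ 2 * w) / α ^ 2 := by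
      field_simp
      ring
    rw [← sub_neg, e]
    exact div_neg_of_neg_of_pos (by linarith) (by positivity)
  exact esymmSix_incompatible (n 0) (n 1) (n 2) (n 3) (n 4) (n 5) (div_pos hγ hα)
    (scale p₂ s₅) (scale p₅ s₂)
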